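/- Let B = [0,1]² and let ℙ be the piece with basic moves (c, d) and (c, −d), where c and d are coprime positive integers. Put ĉ = min(c, d) and d̂ = max(c, d). Then the denominator D(B^q, A_ℙ^q) of the inside-out polytope is given by the following cases, applied in order: it equals 1 if q = 1; it equals d̂ if q = 2; it equals 2d̂ if 3 ≤ q ≤ ⌈d̂/ĉ⌉; and it equals 2ĉd̂ if q ≥ 3 and q ≥ ⌈d̂/ĉ⌉ + 1. -/

import Mathlib

/-! Common definitions: boards, pieces, hyperplane arrangements, rank,
antipode maps, trajectories, augmentations, crossing points, denominators. -/

noncomputable section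

/-- A point of the plane. -/
abbrev Pt : Type := ℝ × ℝ

/-- Dot product on `ℝ²`. -/
def dotp (u v : Pt) : ℝ := u.1 * v.1 + u.2 * v.2

/-- A board: a rational convex polygon `{z | ∀ j, a_j · z ≤ β_j}`, bounded, with
nonempty interior, each defining line meeting the board in at least two points (an edge). -/
structure Board where
  s : ℕ
  A : Fin s → Pt
  β : Fin s → ℝ
  A_rat : ∀ j, ∃ p q : ℚ, A j = ((p : ℝ), (q : ℝ))
  β_rat : ∀ j, ∃ p : ℚ, β j = (p : ℝ)
  bounded : Bornology.IsBounded {z : Pt | ∀ j, dotp (A j) z ≤ β j}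
  int_ne : (interior {z : Pt | ∀ j, dotp (A j) z ≤ β j}).Nonempty
  edges : ∀ j, ∃ u v : Pt, u ≠ v ∧ (∀ k, dotp (A k) u ≤ β k) ∧ (∀ k, dotp (A k) v ≤ β k) ∧
    dotp (A j) u = β j ∧ dotp (A j) v = β j

/-- The set of points of the board. -/
def Board.set (Bd : Board) : Set Pt := {z | ∀ j, dotp (Bd.A j) z ≤ Bd.β j}

/-- The corners of the board: its extreme points. -/
def Board.corners (Bd : Board) : Set Pt := Set.extremePoints ℝ Bd.set

/-- A two-move rider: two nonparallel basic moves `(c r, d r)`, each with coprime entries. -/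
structure Piece where
  c : Bool → ℤ
  d : Bool → ℤ
  coprime : ∀ r, Int.gcd (c r) (d r) = 1
  nonparallel : c false * d true - c true * d false ≠ 0

/-- The basic move vector of `P` of type `r`, as a vector in `ℝ²`. -/
def Piece.mv (P : Piece) (r : Bool) : Pt := ((P.c r : ℝ), (P.d r : ℝ))

/-- The normal vector `(d_r, -c_r)` of the attack equations of type `r`. -/
def Piece.anorm (P : Piece) (r : Bool) : Pt := ((P.d r : ℝ), -(P.c r : ℝ))

/-- A configuration of `q` points in the plane; the configuration space is `ℝ^{2q}`. -/
abbrev Conf (q : ℕ) : Type := Fin q → Pt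

/-- Dot product on the configuration space `ℝ^{2q}`. -/
def confDot {q : ℕ} (u w : Conf q) : ℝ := ∑ k, dotp (u k) (w k)

/-- The vector of `ℝ^{2q}` whose `i`-th planar component is `v` and all others `0`. -/
def unitVec {q : ℕ} (i : Fin q) (v : Pt) : Conf q := fun k => if k = i then v else 0

/-- The normal vector in `ℝ^{2q}` of the attack hyperplane `(w_i - w_j) · v = 0`. -/
def attackNormal {q : ℕ} (i j : Fin q) (v : Pt) : Conf q :=
  fun k => if k = i then v else if k = j then -v else 0

/-- The hyperplane arrangement `H(z)` associated to a configuration `z`: each hyperplane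
`{w | n · w = β}` is recorded as the pair `(n, β)`.  It consists of the attack hyperplanes
through `z` and the fixation hyperplanes through `z`. -/
def HArr (Bd : Board) (P : Piece) {q : ℕ} (z : Conf q) : Set (Conf q × ℝ) :=
  {h | (∃ i j : Fin q, ∃ r : Bool, i < j ∧ dotp (z i - z j) (P.anorm r) = 0 ∧
          h = (attackNormal i j (P.anorm r), 0)) ∨
       (∃ i : Fin q, ∃ e : Fin Bd.s, dotp (Bd.A e) (z i) = Bd.β e ∧
          h = (unitVec i (Bd.A e), Bd.β e))}

/-- The rank of a configuration `z`: the dimension of the span of the normal vectors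
of the hyperplanes of `H(z)`. -/
def confRank (Bd : Board) (P : Piece) {q : ℕ} (z : Conf q) : ℕ :=
  Module.finrank ℝ (Submodule.span ℝ (Prod.fst '' HArr Bd P z))

/-- A configuration has full rank when its rank is `2q`. -/
def FullRank (Bd : Board) (P : Piece) {q : ℕ} (z : Conf q) : Prop :=
  confRank Bd P z = 2 * q

/-- `z ∈ B^q`. -/
def InBoard (Bd : Board) {q : ℕ} (z : Conf q) : Prop := ∀ i, z i ∈ Bd.set

/-- A vertex of the inside-out polytope `(B^q, A_P^q)`: a point of `B^q` that is the unique
common point of some subset of its associated hyperplane arrangement. -/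
def IsVertex (Bd : Board) (P : Piece) {q : ℕ} (z : Conf q) : Prop :=
  InBoard Bd z ∧
    ∃ H' ⊆ HArr Bd P z, {w : Conf q | ∀ h ∈ H', confDot h.1 w = h.2} = {z}

/-- The line through `b` in direction `v` meets the interior of `R`. -/
def meetsInterior (R : Set Pt) (v : Pt) (b : Pt) : Prop := ∃ t : ℝ, b + t • v ∈ interior R

/-- `b'` is the antipode of `b` in direction `v`: if the line through `b` with direction `v`
misses the interior of `R` then `b' = b`; otherwise `b'` is the second intersection point of
the line with the boundary of `R`. -/
def AntipRel (R : Set Pt) (v : Pt) (b b' : Pt) : Prop :=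
  (¬ meetsInterior R v b → b' = b) ∧
  (meetsInterior R v b → b' ∈ frontier R ∧ b' ≠ b ∧ ∃ t : ℝ, b' = b + t • v)

/-- `s` is the antipode map of `R` in direction `v`. -/
def IsAntipodeMap (R : Set Pt) (v : Pt) (s : Pt → Pt) : Prop :=
  ∀ b ∈ frontier R, AntipRel R v b (s b)

/-- The move type used at step `i` of an alternating sequence whose step `0` uses type `st`. -/
def altMove (st : Bool) (i : ℕ) : Bool := if i % 2 = 0 then st else !st

/-- A trajectory: a finite sequence `b 0, …, b (l-1)` of distinct boundary points of `R`,
each obtained from the previous by an antipode map, the move types alternating. -/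
def IsTrajectory (R : Set Pt) (mv : Bool → Pt) (l : ℕ) (b : ℕ → Pt) (st : Bool) : Prop :=
  1 ≤ l ∧ (∀ i, i < l → b i ∈ frontier R) ∧
  (∀ i j, i < l → j < l → b i = b j → i = j) ∧
  (∀ i, i + 1 < l → AntipRel R (mv (altMove st i)) (b i) (b (i + 1)))

/-- A cyclical trajectory: additionally the first point is the antipode of the last,
the move type continuing the alternation. -/
def IsCyclical (R : Set Pt) (mv : Bool → Pt) (l : ℕ) (b : ℕ → Pt) (st : Bool) : Prop :=
  IsTrajectory R mv l b st ∧ AntipRel R (mv (altMove st (l - 1))) (b (l - 1)) (b 0)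

/-- The configuration `(b 1, …, b l) ∈ B^l` formed by the points of a trajectory. -/
def trajConf (l : ℕ) (b : ℕ → Pt) : Conf l := fun i => b i

/-- A corner trajectory: a trajectory containing a corner of the board. -/
def IsCornerTraj (Bd : Board) (P : Piece) (l : ℕ) (b : ℕ → Pt) (st : Bool) : Prop :=
  IsTrajectory Bd.set P.mv l b st ∧ ∃ i, i < l ∧ b i ∈ Bd.corners

/-- A rigid cycle: a cyclical trajectory of full rank. -/
def IsRigidCycle (Bd : Board) (P : Piece) (l : ℕ) (b : ℕ → Pt) (st : Bool) : Prop :=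
  IsCyclical Bd.set P.mv l b st ∧ confRank Bd P (trajConf l b) = 2 * l

/-- The trajectory can be extended backwards (the relevant antipode of its first point
is a different point). -/
def CanExtendBack (R : Set Pt) (mv : Bool → Pt) (b : ℕ → Pt) (st : Bool) : Prop :=
  meetsInterior R (mv (altMove st 1)) (b 0)

/-- The trajectory can be extended forwards (the relevant antipode of its last point
is a different point). -/
def CanExtendFwd (R : Set Pt) (mv : Bool → Pt) (l : ℕ) (b : ℕ → Pt) (st : Bool) : Prop :=
  meetsInterior R (mv (altMove st (l - 1))) (b (l - 1))

/-- `a 0, …, a (L-1)` is the augmentation of the trajectory `b 0, …, b (l-1)`: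
the trajectory with the antipode of its first point prepended whenever it differs from the
first point, and the antipode of its last point appended whenever it differs from the
last point. -/
def IsAugmentation (R : Set Pt) (mv : Bool → Pt) (l : ℕ) (b : ℕ → Pt) (st : Bool)
    (L : ℕ) (a : ℕ → Pt) : Prop :=
  ∃ off : ℕ,
    (∀ i, i < l → a (i + off) = b i) ∧
    (CanExtendBack R mv b st → off = 1 ∧ AntipRel R (mv (altMove st 1)) (b 0) (a 0)) ∧
    (¬ CanExtendBack R mv b st → off = 0) ∧
    (CanExtendFwd R mv l b st →
      L = l + off + 1 ∧ AntipRel R (mv (altMove st (l - 1))) (b (l - 1)) (a (l + off))) ∧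
    (¬ CanExtendFwd R mv l b st → L = l + off)

/-- `c` is a crossing point of the two sequences: an interior point of `R` lying on a
segment of each. -/
def CrossingOfSeqs (R : Set Pt) (La : ℕ) (a : ℕ → Pt) (Lb : ℕ) (bb : ℕ → Pt) (c : Pt) : Prop :=
  c ∈ interior R ∧ ∃ i j, i + 1 < La ∧ j + 1 < Lb ∧
    c ∈ segment ℝ (a i) (a (i + 1)) ∧ c ∈ segment ℝ (bb j) (bb (j + 1))

/-- `c` is a self-crossing point of the sequence: an interior point of `R` lying on two
distinct segments of the sequence. -/
def SelfCrossingOfSeq (R : Set Pt) (La : ℕ) (a : ℕ → Pt) (c : Pt) : Prop :=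
  c ∈ interior R ∧ ∃ i j, i ≠ j ∧ i + 1 < La ∧ j + 1 < La ∧
    c ∈ segment ℝ (a i) (a (i + 1)) ∧ c ∈ segment ℝ (a j) (a (j + 1))

/-- `x` is a rational number whose denominator (in lowest terms) divides `D`. -/
def DenDvd (x : ℝ) (D : ℕ) : Prop := ∃ p : ℚ, (p : ℝ) = x ∧ p.den ∣ D

/-- Both coordinates of `z` are rational with denominators dividing `D`. -/
def PtDenDvd (z : Pt) (D : ℕ) : Prop := DenDvd z.1 D ∧ DenDvd z.2 D

/-- `D` is the denominator of the inside-out polytope `(B^q, A_P^q)`: the least common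
multiple of the denominators of the coordinates of all of its vertices. -/
def IsIOPDenom (Bd : Board) (P : Piece) (q : ℕ) (D : ℕ) : Prop :=
  (∀ z : Conf q, IsVertex Bd P z → ∀ i, PtDenDvd (z i) D) ∧
  (∀ D' : ℕ, (∀ z : Conf q, IsVertex Bd P z → ∀ i, PtDenDvd (z i) D') → D ∣ D')

/-- A finite family of finite sequences of points (with starting move types),
to be used as a family of trajectories. -/
structure TrajFamily where
  m : ℕ
  len : ℕ → ℕ
  pts : ℕ → ℕ → Pt
  st : ℕ → Bool

/-- Every member of the family is a trajectory. -/
def TrajFamily.Wf (F : TrajFamily) (R : Set Pt) (mv : Bool → Pt) : Prop :=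
  ∀ k, k < F.m → IsTrajectory R mv (F.len k) (F.pts k) (F.st k)

/-- The members of the family partition the set `S`: their point sets are pairwise disjoint
with union `S`. -/
def TrajFamily.Partitions (F : TrajFamily) (S : Set Pt) : Prop :=
  {p | ∃ k, k < F.m ∧ ∃ i, i < F.len k ∧ F.pts k i = p} = S ∧
  ∀ k k', k < F.m → k' < F.m → k ≠ k' →
    ∀ i i', i < F.len k → i' < F.len k' → F.pts k i ≠ F.pts k' i'

/-- The family is a partition into maximal trajectories: no point of one member is an
antipode of a point of a different member (no edge of the antipode graph joins two
distinct members). -/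
def TrajFamily.Maximal (F : TrajFamily) (R : Set Pt) (mv : Bool → Pt) : Prop :=
  ∀ k k', k < F.m → k' < F.m → k ≠ k' →
    ∀ i i', i < F.len k → i' < F.len k' →
      ∀ r : Bool, ¬ AntipRel R (mv r) (F.pts k i) (F.pts k' i')

/-- The unit square `[0,1]²`. -/
def unitSq : Set Pt := Set.Icc ((0, 0) : Pt) ((1, 1) : Pt)

end

noncomputable section

/-! ### Infinitesimal motions -/

/-- `δ` solves the homogeneous equations attached to the hyperplanes through `z`, for the moves
`(c, d)`, `(c, -d)` on the unit square. -/
structure IsMotion (c d : ℕ) {q : ℕ} (z δ : Conf q) : Prop where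
  plus : ∀ i j, d * (z i).1 + c * (z i).2 = d * (z j).1 + c * (z j).2 →
    d * (δ i).1 + c * (δ i).2 = d * (δ j).1 + c * (δ j).2
  minus : ∀ i j, d * (z i).1 - c * (z i).2 = d * (z j).1 - c * (z j).2 →
    d * (δ i).1 - c * (δ i).2 = d * (δ j).1 - c * (δ j).2
  fst : ∀ i, (z i).1 = 0 ∨ (z i).1 = 1 → (δ i).1 = 0
  snd : ∀ i, (z i).2 = 0 ∨ (z i).2 = 1 → (δ i).2 = 0

/-- A configuration in the unit square admitting no nonzero motion. -/
def IsRigid (c d : ℕ) {q : ℕ} (z : Conf q) : Prop :=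
  (∀ i, z i ∈ unitSq) ∧ ∀ δ, IsMotion c d z δ → δ = 0

/-- `D` is the least common multiple of the denominators of the rigid configurations. -/
def IsRigidDenom (c d q D : ℕ) : Prop :=
  (∀ z : Conf q, IsRigid c d z → ∀ i, PtDenDvd (z i) D) ∧
  ∀ D' : ℕ, (∀ z : Conf q, IsRigid c d z → ∀ i, PtDenDvd (z i) D') → D ∣ D'

theorem mem_unitSq {p : Pt} : p ∈ unitSq ↔ 0 ≤ p.1 ∧ p.1 ≤ 1 ∧ 0 ≤ p.2 ∧ p.2 ≤ 1 := by
  simp only [unitSq, Set.mem_Icc, Prod.le_def]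
  tauto

theorem IsRigid.swap {c d q : ℕ} {z : Conf q} (h : IsRigid c d z) :
    IsRigid d c (fun i => (z i).swap) := by
  refine ⟨fun i => ?_, fun δ hδ => ?_⟩
  · have := mem_unitSq.1 (h.1 i)
    exact mem_unitSq.2 ⟨this.2.2.1, this.2.2.2, this.1, this.2.1⟩
  · have key : (fun i => (δ i).swap) = (0 : Conf q) := h.2 _
      { plus := fun i j e => by
          have := hδ.plus i j (by simp only [Prod.fst_swap, Prod.snd_swap]; linarith)
          simp only [Prod.fst_swap, Prod.snd_swap]; linarith
        minus := fun i j e => by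
          have := hδ.minus i j (by simp only [Prod.fst_swap, Prod.snd_swap]; linarith)
          simp only [Prod.fst_swap, Prod.snd_swap]; linarith
        fst := fun i e => hδ.snd i e
        snd := fun i e => hδ.fst i e }
    funext i
    have := congrFun key i
    simp only [Pi.zero_apply] at this ⊢
    rw [← Prod.swap_swap (δ i), this]; rfl

theorem IsRigidDenom.swap {c d q D : ℕ} (h : IsRigidDenom c d q D) : IsRigidDenom d c q D :=
  ⟨fun _ hz i => (h.1 _ hz.swap i).symm,
    fun D' hD' => h.2 D' fun _ hz i => (hD' _ hz.swap i).symm⟩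

/-! ### Vertices of the inside-out polytope are the rigid configurations -/

theorem confDot_unitVec {q : ℕ} (i : Fin q) (v : Pt) (w : Conf q) :
    confDot (unitVec i v) w = dotp v (w i) := by
  unfold confDot unitVec
  rw [Finset.sum_eq_single i]
  · simp
  · intro k _ hk; simp [hk, dotp]
  · simp

theorem confDot_attackNormal {q : ℕ} {i j : Fin q} (hij : i ≠ j) (v : Pt) (w : Conf q) :
    confDot (attackNormal i j v) w = dotp (w i - w j) v := by
  have : confDot (attackNormal i j v) w =
      confDot (unitVec i v) w + confDot (unitVec j (-v)) w := by
    unfold confDot unitVec attackNormal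
    rw [← Finset.sum_add_distrib]
    refine Finset.sum_congr rfl fun k _ => ?_
    by_cases hi : k = i
    · subst hi; simp [hij, dotp]
    · simp [hi, dotp]
  rw [this, confDot_unitVec, confDot_unitVec]
  simp only [dotp, Prod.fst_neg, Prod.snd_neg, Prod.fst_sub, Prod.snd_sub]
  ring

/-- The side of a polygon with midpoint `m`, half-extent `τ` and outward direction `n` lies on
one of the defining lines. -/
theorem Board.exists_side (Bd : Board) {m τ n : Pt} (hm : m ∈ Bd.set) (h₁ : m + τ ∈ Bd.set)
    (h₂ : m - τ ∈ Bd.set) (hn : ∀ t : ℝ, 0 < t → m + t • n ∉ Bd.set) :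
    ∃ e, 0 < dotp (Bd.A e) n ∧ dotp (Bd.A e) m = Bd.β e ∧ dotp (Bd.A e) τ = 0 := by
  have lin : ∀ (a u v : Pt) (t : ℝ), dotp a (u + t • v) = dotp a u + t * dotp a v := by
    intro a u v t
    simp only [dotp, Prod.fst_add, Prod.snd_add, Prod.smul_fst, Prod.smul_snd, smul_eq_mul]
    ring
  obtain ⟨e, he₁, he₂⟩ : ∃ e, 0 < dotp (Bd.A e) n ∧ dotp (Bd.A e) m = Bd.β e := by
    by_contra! hcon
    have hev : ∀ᶠ t : ℝ in nhdsWithin 0 (Set.Ioi 0), ∀ e, dotp (Bd.A e) (m + t • n) ≤ Bd.β e := by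
      rw [Filter.eventually_all]
      intro e
      rcases le_or_gt (dotp (Bd.A e) n) 0 with hle | hlt
      · filter_upwards [self_mem_nhdsWithin] with t ht
        rw [lin]
        have := hm e
        nlinarith [Set.mem_Ioi.1 ht]
      · have hlt' : dotp (Bd.A e) m < Bd.β e := lt_of_le_of_ne (hm e) (hcon e hlt)
        have hcont : Continuous fun t : ℝ => dotp (Bd.A e) m + t * dotp (Bd.A e) n := by fun_prop
        have : ∀ᶠ t : ℝ in nhds 0, dotp (Bd.A e) m + t * dotp (Bd.A e) n < Bd.β e :=
          hcont.continuousAt.eventually_lt continuousAt_const (by simpa using hlt')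
        filter_upwards [nhdsWithin_le_nhds this] with t ht
        rw [lin]; exact ht.le
    obtain ⟨t, ht, ht₀⟩ := (hev.and self_mem_nhdsWithin).exists
    exact hn t ht₀ ht
  refine ⟨e, he₁, he₂, le_antisymm ?_ ?_⟩
  · have := h₁ e
    rw [← one_smul ℝ τ, lin] at this
    linarith
  · have := h₂ e
    rw [sub_eq_add_neg, ← neg_one_smul ℝ τ, lin] at this
    linarith

/-- A linear form maximal on the unit square at `p` only involves the coordinates of `p` that
are on the boundary. -/
theorem dotp_eq_zero_of_maximal {a p δ : Pt} {β : ℝ} (hmax : ∀ r ∈ unitSq, dotp a r ≤ β)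
    (hp : p ∈ unitSq) (hpβ : dotp a p = β) (h₁ : p.1 = 0 ∨ p.1 = 1 → δ.1 = 0)
    (h₂ : p.2 = 0 ∨ p.2 = 1 → δ.2 = 0) : dotp a δ = 0 := by
  obtain ⟨hx0, hx1, hy0, hy1⟩ := mem_unitSq.1 hp
  have side : ∀ b x γ : ℝ, 0 < x → x < 1 → b * x = γ → b * 0 ≤ γ → b * 1 ≤ γ → b = 0 := by
    intro b x γ hx hx' e l r
    nlinarith
  have a1 : a.1 * δ.1 = 0 := by
    by_cases h : p.1 = 0 ∨ p.1 = 1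
    · rw [h₁ h, mul_zero]
    · push Not at h
      have l := hmax (0, p.2) (mem_unitSq.2 ⟨le_rfl, zero_le_one, hy0, hy1⟩)
      have r := hmax (1, p.2) (mem_unitSq.2 ⟨zero_le_one, le_rfl, hy0, hy1⟩)
      simp only [dotp] at l r hpβ
      rw [side a.1 p.1 (β - a.2 * p.2) (lt_of_le_of_ne hx0 h.1.symm) (lt_of_le_of_ne hx1 h.2)
        (by linarith) (by linarith) (by linarith), zero_mul]
  have a2 : a.2 * δ.2 = 0 := by
    by_cases h : p.2 = 0 ∨ p.2 = 1
    · rw [h₂ h, mul_zero]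
    · push Not at h
      have l := hmax (p.1, 0) (mem_unitSq.2 ⟨hx0, hx1, le_rfl, zero_le_one⟩)
      have r := hmax (p.1, 1) (mem_unitSq.2 ⟨hx0, hx1, zero_le_one, le_rfl⟩)
      simp only [dotp] at l r hpβ
      rw [side a.2 p.2 (β - a.1 * p.1) (lt_of_le_of_ne hy0 h.1.symm) (lt_of_le_of_ne hy1 h.2)
        (by linarith) (by linarith) (by linarith), zero_mul]
  rw [dotp, a1, a2, add_zero]

/-- A point moved along the defining lines of a square board through it keeps its coordinates
that are on the boundary. -/
theorem Board.eq_of_mem_sides (Bd : Board) (hBd : Bd.set = unitSq) {p w : Pt}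
    (h : ∀ e, dotp (Bd.A e) p = Bd.β e → dotp (Bd.A e) w = Bd.β e) :
    (p.1 = 0 ∨ p.1 = 1 → w.1 = p.1) ∧ (p.2 = 0 ∨ p.2 = 1 → w.2 = p.2) := by
  refine ⟨?_, ?_⟩
  · rintro (h0 | h0)
    · obtain ⟨e, e1, e2, e3⟩ := Bd.exists_side (m := (0, 1 / 2)) (τ := (0, 1 / 2)) (n := (-1, 0))
        (by rw [hBd, mem_unitSq]; norm_num) (by rw [hBd, mem_unitSq]; norm_num)
        (by rw [hBd, mem_unitSq]; norm_num)
        (by intro t ht; rw [hBd, mem_unitSq]; simp [ht])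
      have := h e
      simp only [dotp] at e1 e2 e3 this
      have a2 : (Bd.A e).2 = 0 := by linarith
      have hβ : Bd.β e = 0 := by linarith
      simp only [a2, hβ, h0, mul_zero, zero_mul, add_zero, true_imp_iff] at this ⊢
      exact (mul_eq_zero.1 this).resolve_left (by intro h; rw [h] at e1; norm_num [a2] at e1)
    · obtain ⟨e, e1, e2, e3⟩ := Bd.exists_side (m := (1, 1 / 2)) (τ := (0, 1 / 2)) (n := (1, 0))
        (by rw [hBd, mem_unitSq]; norm_num) (by rw [hBd, mem_unitSq]; norm_num)
        (by rw [hBd, mem_unitSq]; norm_num)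
        (by intro t ht; rw [hBd, mem_unitSq]; simp; intros; linarith)
      have := h e
      simp only [dotp] at e1 e2 e3 this
      have a2 : (Bd.A e).2 = 0 := by linarith
      have hβ : Bd.β e = (Bd.A e).1 := by linarith
      simp only [a2, hβ, h0, zero_mul, mul_one, add_zero, true_imp_iff] at this ⊢
      exact mul_left_cancel₀ (by intro h; rw [h] at e1; norm_num [a2] at e1)
        (this.trans (mul_one _).symm)
  · rintro (h0 | h0)
    · obtain ⟨e, e1, e2, e3⟩ := Bd.exists_side (m := (1 / 2, 0)) (τ := (1 / 2, 0)) (n := (0, -1))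
        (by rw [hBd, mem_unitSq]; norm_num) (by rw [hBd, mem_unitSq]; norm_num)
        (by rw [hBd, mem_unitSq]; norm_num)
        (by intro t ht; rw [hBd, mem_unitSq]; simp [ht])
      have := h e
      simp only [dotp] at e1 e2 e3 this
      have a2 : (Bd.A e).1 = 0 := by linarith
      have hβ : Bd.β e = 0 := by linarith
      simp only [a2, hβ, h0, mul_zero, zero_mul, zero_add, add_zero, true_imp_iff] at this ⊢
      exact (mul_eq_zero.1 this).resolve_left (by intro h; rw [h] at e1; norm_num [a2] at e1)
    · obtain ⟨e, e1, e2, e3⟩ := Bd.exists_side (m := (1 / 2, 1)) (τ := (1 / 2, 0)) (n := (0, 1))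
        (by rw [hBd, mem_unitSq]; norm_num) (by rw [hBd, mem_unitSq]; norm_num)
        (by rw [hBd, mem_unitSq]; norm_num)
        (by intro t ht; rw [hBd, mem_unitSq]; simp; intros; linarith)
      have := h e
      simp only [dotp] at e1 e2 e3 this
      have a2 : (Bd.A e).1 = 0 := by linarith
      have hβ : Bd.β e = (Bd.A e).2 := by linarith
      simp only [a2, hβ, h0, zero_mul, mul_one, zero_add, true_imp_iff] at this ⊢
      exact mul_left_cancel₀ (by intro h; rw [h] at e1; norm_num [a2] at e1)
        (this.trans (mul_one _).symm)

theorem isVertex_iff_isRigid {c d : ℕ} (Bd : Board) (hBd : Bd.set = unitSq)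
    (P : Piece) (h1 : P.c false = (c : ℤ)) (h2 : P.d false = (d : ℤ))
    (h3 : P.c true = (c : ℤ)) (h4 : P.d true = -(d : ℤ)) {q : ℕ} (z : Conf q) :
    IsVertex Bd P z ↔ IsRigid c d z := by
  have hminus : ∀ p : Pt, dotp p (P.anorm false) = d * p.1 - c * p.2 := by
    intro p; simp only [dotp, Piece.anorm, h1, h2]; push_cast; ring
  have hplus : ∀ p : Pt, dotp p (P.anorm true) = -(d * p.1 + c * p.2) := by
    intro p; simp only [dotp, Piece.anorm, h3, h4]; push_cast; ring
  have hin : InBoard Bd z ↔ ∀ i, z i ∈ unitSq := by rw [InBoard, hBd]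
  rw [IsVertex, IsRigid, hin]
  refine and_congr_right fun hz => ⟨?_, ?_⟩
  · rintro ⟨H', hH', huniq⟩ δ hδ
    suffices z + δ ∈ ({z} : Set (Conf q)) by simpa using this
    rw [← huniq]
    intro h hh
    rcases hH' hh with ⟨i, j, r, hij, hr, rfl⟩ | ⟨i, e, he, rfl⟩
    · rw [confDot_attackNormal hij.ne]
      cases r
      · rw [hminus] at hr ⊢
        simp only [Prod.fst_sub, Prod.snd_sub, Pi.add_apply, Prod.fst_add, Prod.snd_add] at hr ⊢
        have := hδ.minus i j (by linarith)
        linarith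
      · rw [hplus] at hr ⊢
        simp only [Prod.fst_sub, Prod.snd_sub, Pi.add_apply, Prod.fst_add, Prod.snd_add] at hr ⊢
        have := hδ.plus i j (by linarith)
        linarith
    · rw [confDot_unitVec]
      have := dotp_eq_zero_of_maximal (δ := δ i)
        (fun r hr => by rw [← hBd] at hr; exact hr e) (hz i) he (hδ.fst i) (hδ.snd i)
      simp only [dotp, Pi.add_apply, Prod.fst_add, Prod.snd_add] at this he ⊢
      linarith
  · intro hrig
    refine ⟨_, subset_rfl, Set.eq_singleton_iff_unique_mem.2 ⟨?_, fun w hw => ?_⟩⟩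
    · rintro h (⟨i, j, r, hij, hr, rfl⟩ | ⟨i, e, he, rfl⟩)
      · rw [confDot_attackNormal hij.ne, hr]
      · rw [confDot_unitVec, he]
    have hatt : ∀ (r : Bool) (i j : Fin q), dotp (z i - z j) (P.anorm r) = 0 →
        dotp (w i - w j) (P.anorm r) = 0 := by
      have flip : ∀ u v n : Pt, dotp (u - v) n = -dotp (v - u) n := by
        intro u v n; simp only [dotp, Prod.fst_sub, Prod.snd_sub]; ring
      intro r i j hr
      rcases lt_trichotomy i j with hij | rfl | hij
      · have := hw _ (Or.inl ⟨i, j, r, hij, hr, rfl⟩)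
        rwa [confDot_attackNormal hij.ne] at this
      · simp [dotp]
      · rw [flip, neg_eq_zero] at hr ⊢
        have := hw _ (Or.inl ⟨j, i, r, hij, hr, rfl⟩)
        rwa [confDot_attackNormal hij.ne] at this
    have hside : ∀ i, _ := fun i => Bd.eq_of_mem_sides hBd (p := z i) (w := w i) fun e he => by
      have := hw _ (Or.inr ⟨i, e, he, rfl⟩)
      rwa [confDot_unitVec] at this
    refine sub_eq_zero.1 (hrig (w - z) ⟨fun i j e => ?_, fun i j e => ?_, fun i e => ?_,
      fun i e => ?_⟩)
    · have := hatt true i j (by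
        rw [hplus]; simp only [Prod.fst_sub, Prod.snd_sub]; linarith)
      rw [hplus] at this
      simp only [Prod.fst_sub, Prod.snd_sub, Pi.sub_apply] at this ⊢
      linarith
    · have := hatt false i j (by
        rw [hminus]; simp only [Prod.fst_sub, Prod.snd_sub]; linarith)
      rw [hminus] at this
      simp only [Prod.fst_sub, Prod.snd_sub, Pi.sub_apply] at this ⊢
      linarith
    · simp [(hside i).1 e]
    · simp [(hside i).2 e]

/-! ### Denominators -/

theorem DenDvd.of_mul_eq {x : ℝ} {D : ℕ} (hD : D ≠ 0) {n : ℤ} (h : D * x = n) : DenDvd x D := by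
  refine ⟨n / (D : ℤ), ?_, by exact_mod_cast Rat.den_dvd n D⟩
  have : (D : ℝ) ≠ 0 := by exact_mod_cast hD
  push_cast
  field_simp
  linarith

theorem DenDvd.exists_mul_eq {x : ℝ} {D : ℕ} (h : DenDvd x D) : ∃ n : ℤ, D * x = n := by
  obtain ⟨p, rfl, k, rfl⟩ := h
  refine ⟨k * p.num, ?_⟩
  have : ((p * p.den : ℚ) : ℝ) = ((p.num : ℚ) : ℝ) := by rw [Rat.mul_den_eq_num]
  push_cast at this ⊢
  rw [← this]; ring

/-! ### Upper bounds -/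

/-- Functions `f i` of the two line parameters of the points that respect attacks, the
translation between the horizontal sides, and the reflections in the vertical sides, vanish on
the parameters of a rigid configuration. -/
theorem IsRigid.wave {c d q : ℕ} (hc : 0 < c) (hd : 0 < d) {z : Conf q} (hz : IsRigid c d z)
    (f : Fin q → ℝ → ℝ)
    (hplus : ∀ i j, d * (z i).1 + c * (z i).2 = d * (z j).1 + c * (z j).2 → f i = f j)
    (hminus : ∀ i j, d * (z i).1 - c * (z i).2 = d * (z j).1 - c * (z j).2 → f i = f j)
    (hper : ∀ i t, f i (t + 2 * c) = f i t)
    (hleft : ∀ i, (z i).1 = 0 → ∀ t, f i (-t) = -f i t)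
    (hright : ∀ i, (z i).1 = 1 → ∀ t, f i (2 * d - t) = -f i t) (i : Fin q) :
    f i (d * (z i).1 + c * (z i).2) = 0 ∧ f i (d * (z i).1 - c * (z i).2) = 0 := by
  have hc' : (c : ℝ) ≠ 0 := by exact_mod_cast hc.ne'
  have hd' : (d : ℝ) ≠ 0 := by exact_mod_cast hd.ne'
  let V : Fin q → ℝ := fun i => f i (d * (z i).1 + c * (z i).2)
  let U : Fin q → ℝ := fun i => f i (d * (z i).1 - c * (z i).2)
  let δ : Conf q := fun i => ((V i + U i) / (2 * d), (V i - U i) / (2 * c))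
  have hV : ∀ i, d * (δ i).1 + c * (δ i).2 = V i := by
    intro i; simp only [δ]; field_simp; ring
  have hU : ∀ i, d * (δ i).1 - c * (δ i).2 = U i := by
    intro i; simp only [δ]; field_simp; ring
  have hδ : δ = 0 := by
    refine hz.2 δ ⟨fun i j e => ?_, fun i j e => ?_, fun i e => ?_, fun i e => ?_⟩
    · rw [hV, hV]; simp only [V]; rw [hplus i j e, e]
    · rw [hU, hU]; simp only [U]; rw [hminus i j e, e]
    · have : V i + U i = 0 := by
        simp only [V, U]
        rcases e with e | e
        · rw [← neg_neg (d * (z i).1 + c * (z i).2), hleft i e, e]; ring_nf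
        · rw [show (d * (z i).1 + c * (z i).2 : ℝ) = 2 * d - (d * (z i).1 - c * (z i).2) by
            rw [e]; ring, hright i e]; ring
      simp only [δ, this, zero_div]
    · have : V i - U i = 0 := by
        simp only [V, U]
        rcases e with e | e
        · rw [e]; simp
        · rw [show (d * (z i).1 + c * (z i).2 : ℝ) = (d * (z i).1 - c * (z i).2) + 2 * c by
            rw [e]; ring, hper i]; ring
      simp only [δ, this, zero_div]
  refine ⟨?_, ?_⟩
  · simpa [hδ] using (hV i).symm
  · simpa [hδ] using (hU i).symm

theorem IsRigid.exists_int {c d q : ℕ} (hc : 0 < c) (hd : 0 < d) {z : Conf q}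
    (hz : IsRigid c d z) (i : Fin q) :
    ∃ m n : ℤ, d * (z i).1 + c * (z i).2 = m ∧ d * (z i).1 - c * (z i).2 = n := by
  have := hz.wave hc hd (fun _ t => Real.sin (t * Real.pi)) (fun _ _ _ => rfl) (fun _ _ _ => rfl)
    (fun _ t => by
      rw [show (t + 2 * c) * Real.pi = t * Real.pi + c * (2 * Real.pi) by ring,
        Real.sin_add_nat_mul_two_pi])
    (fun _ _ t => by rw [neg_mul, Real.sin_neg])
    (fun _ _ t => by
      rw [show (2 * d - t) * Real.pi = d * (2 * Real.pi) - t * Real.pi by ring,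
        Real.sin_nat_mul_two_pi_sub]) i
  simp only [Real.sin_eq_zero_iff] at this
  obtain ⟨⟨m, hm⟩, n, hn⟩ := this
  exact ⟨m, n, (mul_right_cancel₀ Real.pi_ne_zero hm).symm,
    (mul_right_cancel₀ Real.pi_ne_zero hn).symm⟩

/-- Too few points to step from `x = 0` to `x = 1` with horizontal steps of at most `c / d`
leave a gap wider than that. -/
theorem exists_gap {c d q : ℕ} (hc : 0 < c) (hd : 0 < d) (hq : q ≤ (d + c - 1) / c)
    (x : Fin q → ℝ) (hx : ∀ i, 0 ≤ x i) :
    ∃ t : ℝ, t < d ∧ ∀ i, d * x i ≤ t ∨ (t + c < d * x i ∧ x i ≠ 0) := by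
  have hd' : (0 : ℝ) < d := by exact_mod_cast hd
  have hc' : (0 : ℝ) < c := by exact_mod_cast hc
  by_cases h0 : ∃ i, x i = 0
  · obtain ⟨i₀, hi₀⟩ := h0
    by_contra! hcon
    have hsmall : ∀ k : Fin ((d + c - 1) / c), (k : ℝ) * c < d := by
      intro k
      have h1 := Nat.div_mul_le_self (d + c - 1) c
      have h2 : (k + 1) * c ≤ (d + c - 1) / c * c := Nat.mul_le_mul_right c k.2
      have : (k : ℕ) * c < d := by
        rw [add_mul, one_mul] at h2; omega
      exact_mod_cast this
    have hex : ∀ k : Fin ((d + c - 1) / c), ∃ i, (k : ℝ) * c < d * x i ∧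
        d * x i ≤ (k + 1) * c := by
      intro k
      obtain ⟨i, hi, hi'⟩ := hcon (k * c) (hsmall k)
      refine ⟨i, hi, not_lt.1 fun hlt => ?_⟩
      have := hi' (by linarith)
      rw [this, mul_zero] at hi
      exact absurd hi (not_lt.2 (by positivity))
    choose g hg hg' using hex
    have hinj : Function.Injective g := by
      have key : ∀ k l, g k = g l → (k : ℕ) ≤ l := by
        intro k l hkl
        have h1 := hg k
        have h2 := hg' l
        rw [← hkl] at h2
        have : (k : ℝ) < l + 1 := lt_of_mul_lt_mul_right (h1.trans_le h2) hc'.le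
        exact Nat.lt_succ_iff.1 (by exact_mod_cast this)
      intro k l hkl
      exact Fin.ext (le_antisymm (key k l hkl) (key l k hkl.symm))
    have := Fintype.card_lt_of_injective_of_notMem g hinj (b := i₀) (by
      rintro ⟨k, hk⟩
      have := hg k
      rw [hk, hi₀, mul_zero] at this
      exact absurd this (not_lt.2 (by positivity)))
    rw [Fintype.card_fin, Fintype.card_fin] at this
    omega
  · push Not at h0
    refine ⟨-1 - c, by linarith, fun i => Or.inr ⟨?_, h0 i⟩⟩
    have := mul_nonneg hd'.le (hx i)
    linarith

theorem IsRigid.exists_int_two_mul_snd {c d q : ℕ} (hc : 0 < c) (hd : 0 < d)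
    (hq : q ≤ (d + c - 1) / c) {z : Conf q} (hz : IsRigid c d z) (i : Fin q) :
    ∃ n : ℤ, 2 * (z i).2 = n := by
  have hd' : (0 : ℝ) < d := by exact_mod_cast hd
  have hc' : (0 : ℝ) < c := by exact_mod_cast hc
  have hsq := fun i => mem_unitSq.1 (hz.1 i)
  obtain ⟨t, ht, hgap⟩ := exists_gap hc hd hq (fun i => (z i).1) (fun i => (hsq i).1)
  have hsep : ∀ i j, d * (z i).1 ≤ t → ¬ d * (z j).1 ≤ t →
      c * (z j).2 - c * (z i).2 < d * (z j).1 - d * (z i).1 ∧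
      c * (z i).2 - c * (z j).2 < d * (z j).1 - d * (z i).1 := by
    intro i j hi hj
    have h1 := ((hgap j).resolve_left hj).1
    have := hsq i
    have := hsq j
    constructor <;> nlinarith
  let g : ℝ → ℝ → ℝ := fun s y => Real.sin ((y - s) / c * Real.pi)
  have gper : ∀ s y, g s (y + 2 * c) = g s y := by
    intro s y
    simp only [g]
    rw [show (y + 2 * c - s) / c * Real.pi = (y - s) / c * Real.pi + 2 * Real.pi by
      field_simp; ring, Real.sin_add_two_pi]
  have godd : ∀ s y, g s (2 * s - y) = -g s y := by
    intro s y
    simp only [g]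
    rw [← Real.sin_neg]; congr 1; ring
  have key := hz.wave hc hd (fun i => if d * (z i).1 ≤ t then g 0 else g d)
    (fun i j e => by
      by_cases hi : d * (z i).1 ≤ t <;> by_cases hj : d * (z j).1 ≤ t <;>
        simp only [hi, hj, if_true, if_false]
      · have := (hsep i j hi hj).2; linarith
      · have := (hsep j i hj hi).2; linarith)
    (fun i j e => by
      by_cases hi : d * (z i).1 ≤ t <;> by_cases hj : d * (z j).1 ≤ t <;>
        simp only [hi, hj, if_true, if_false]
      · have := (hsep i j hi hj).1; linarith
      · have := (hsep j i hj hi).1; linarith)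
    (fun i y => by
      by_cases hi : d * (z i).1 ≤ t <;> simp only [hi, if_true, if_false, gper])
    (fun i e y => by
      have hi : d * (z i).1 ≤ t := (hgap i).resolve_right fun h => h.2 e
      simp only [hi, if_true]
      simpa using godd 0 y)
    (fun i e y => by
      have hi : ¬ d * (z i).1 ≤ t := by rw [e]; linarith
      simp only [hi, if_false, godd])
    i
  have fin : ∀ s, g s (d * (z i).1 + c * (z i).2) = 0 ∧ g s (d * (z i).1 - c * (z i).2) = 0 →
      ∃ n : ℤ, 2 * (z i).2 = n := by
    rintro s ⟨h1, h2⟩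
    obtain ⟨m, hm⟩ := Real.sin_eq_zero_iff.1 h1
    obtain ⟨n, hn⟩ := Real.sin_eq_zero_iff.1 h2
    have hm := mul_right_cancel₀ Real.pi_ne_zero hm
    have hn := mul_right_cancel₀ Real.pi_ne_zero hn
    refine ⟨m - n, ?_⟩
    push_cast
    rw [hm, hn]; field_simp; ring
  by_cases hi : d * (z i).1 ≤ t
  · simp only [hi, if_true] at key
    exact fin 0 key
  · simp only [hi, if_false] at key
    exact fin d key

/-- Both coordinates are `0` or `1`. -/
def AtCorner (p : Pt) : Prop := (p.1 = 0 ∨ p.1 = 1) ∧ (p.2 = 0 ∨ p.2 = 1)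

theorem AtCorner.ptDenDvd {p : Pt} (h : AtCorner p) (D : ℕ) : PtDenDvd p D := by
  have : ∀ x : ℝ, x = 0 ∨ x = 1 → DenDvd x D := by
    rintro x (rfl | rfl)
    · exact ⟨0, by simp⟩
    · exact ⟨1, by simp⟩
  exact ⟨this _ h.1, this _ h.2⟩

/-- A point that is not a corner can move in a coordinate direction respecting the sides. -/
theorem exists_free_direction {p : Pt} (h : ¬ AtCorner p) :
    ∃ e : Pt, (p.1 = 0 ∨ p.1 = 1 → e.1 = 0) ∧ (p.2 = 0 ∨ p.2 = 1 → e.2 = 0) ∧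
      (e = (1, 0) ∨ e = (0, 1)) := by
  by_cases h1 : p.1 = 0 ∨ p.1 = 1
  · have h2 : ¬ (p.2 = 0 ∨ p.2 = 1) := fun h2 => h ⟨h1, h2⟩
    exact ⟨(0, 1), by simp, fun h' => absurd h' h2, Or.inr rfl⟩
  · exact ⟨(1, 0), fun h' => absurd h' h1, by simp, Or.inl rfl⟩

theorem IsRigid.atCorner_of_not_attack {c d q : ℕ} {z : Conf q} (hz : IsRigid c d z) {i : Fin q}
    (hplus : ∀ j ≠ i, d * (z i).1 + c * (z i).2 ≠ d * (z j).1 + c * (z j).2)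
    (hminus : ∀ j ≠ i, d * (z i).1 - c * (z i).2 ≠ d * (z j).1 - c * (z j).2) :
    AtCorner (z i) := by
  by_contra hcor
  obtain ⟨e, e1, e2, he⟩ := exists_free_direction hcor
  have := congrFun (hz.2 (Pi.single i e) ⟨?_, ?_, ?_, ?_⟩) i
  · rw [Pi.single_eq_same] at this
    rcases he with rfl | rfl <;> simp at this
  · intro j k hjk
    by_cases hj : j = i <;> by_cases hk : k = i
    · rw [hj, hk]
    · subst hj; exact absurd hjk (hplus k hk)
    · subst hk; exact absurd hjk.symm (hplus j hj)
    · simp [hj, hk]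
  · intro j k hjk
    by_cases hj : j = i <;> by_cases hk : k = i
    · rw [hj, hk]
    · subst hj; exact absurd hjk (hminus k hk)
    · subst hk; exact absurd hjk.symm (hminus j hj)
    · simp [hj, hk]
  · intro j hj
    by_cases h : j = i
    · subst h; simpa using e1 hj
    · simp [h]
  · intro j hj
    by_cases h : j = i
    · subst h; simpa using e2 hj
    · simp [h]

/-- Reflecting the square in its horizontal axis preserves rigidity. -/
theorem IsRigid.reflect {c d q : ℕ} {z : Conf q} (hz : IsRigid c d z) :
    IsRigid c d (fun i => ((z i).1, 1 - (z i).2)) := by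
  refine ⟨fun i => ?_, fun δ hδ => ?_⟩
  · have := mem_unitSq.1 (hz.1 i)
    exact mem_unitSq.2 ⟨this.1, this.2.1, by linarith, by linarith⟩
  · have key : (fun i => ((δ i).1, -(δ i).2)) = (0 : Conf q) := hz.2 _
      { plus := fun i j e => by
          have := hδ.minus i j (by linarith)
          linarith
        minus := fun i j e => by
          have := hδ.plus i j (by linarith)
          linarith
        fst := fun i e => hδ.fst i e
        snd := fun i e => by
          have := hδ.snd i (by rcases e with e | e <;> simp [e])
          simp [this] }
    funext i
    have := congrFun key i
    simp only [Pi.zero_apply, Prod.ext_iff, Prod.fst_zero, Prod.snd_zero, neg_eq_zero] at this ⊢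
    exact this

theorem IsRigid.eq_zero_of_pair {c d : ℕ} {z : Conf 2} (hz : IsRigid c d z) {i j : Fin 2}
    (hij : i ≠ j) {a b : Pt}
    (hplus : d * (z i).1 + c * (z i).2 = d * (z j).1 + c * (z j).2 →
      d * a.1 + c * a.2 = d * b.1 + c * b.2)
    (hminus : d * (z i).1 - c * (z i).2 = d * (z j).1 - c * (z j).2 →
      d * a.1 - c * a.2 = d * b.1 - c * b.2)
    (ha₁ : (z i).1 = 0 ∨ (z i).1 = 1 → a.1 = 0) (ha₂ : (z i).2 = 0 ∨ (z i).2 = 1 → a.2 = 0)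
    (hb₁ : (z j).1 = 0 ∨ (z j).1 = 1 → b.1 = 0) (hb₂ : (z j).2 = 0 ∨ (z j).2 = 1 → b.2 = 0) :
    a = 0 := by
  have huniv : ∀ k : Fin 2, k = i ∨ k = j := by omega
  let δ : Conf 2 := fun k => if k = i then a else b
  have hi : δ i = a := if_pos rfl
  have hj : δ j = b := if_neg hij.symm
  rw [← hi, hz.2 δ ⟨?_, ?_, ?_, ?_⟩, Pi.zero_apply]
  · intro k l e
    rcases huniv k with rfl | rfl <;> rcases huniv l with rfl | rfl
    · rfl
    · rw [hi, hj]; exact hplus e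
    · rw [hi, hj]; exact (hplus e.symm).symm
    · rfl
  · intro k l e
    rcases huniv k with rfl | rfl <;> rcases huniv l with rfl | rfl
    · rfl
    · rw [hi, hj]; exact hminus e
    · rw [hi, hj]; exact (hminus e.symm).symm
    · rfl
  · intro k e
    rcases huniv k with rfl | rfl
    · rw [hi]; exact ha₁ e
    · rw [hj]; exact hb₁ e
  · intro k e
    rcases huniv k with rfl | rfl
    · rw [hi]; exact ha₂ e
    · rw [hj]; exact hb₂ e

/-- The attack case of the upper bound for two points. -/
theorem IsRigid.ptDenDvd_of_attack {c d : ℕ} (hc : 0 < c) (hcd : c ≤ d)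
    {z : Conf 2} (hz : IsRigid c d z) {i j : Fin 2} (hij : i ≠ j)
    (h : d * (z i).1 - c * (z i).2 = d * (z j).1 - c * (z j).2) : PtDenDvd (z i) d := by
  have hd : 0 < d := hc.trans_le hcd
  have hc' : (0 : ℝ) < c := by exact_mod_cast hc
  have hd' : (0 : ℝ) < d := by exact_mod_cast hd
  have hcd' : (c : ℝ) ≤ d := by exact_mod_cast hcd
  by_cases hcor : AtCorner (z i)
  · exact hcor.ptDenDvd d
  have hfree : ∀ p : Pt, ¬ AtCorner p → ∃ e : Pt, (p.1 = 0 ∨ p.1 = 1 → e.1 = 0) ∧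
      (p.2 = 0 ∨ p.2 = 1 → e.2 = 0) ∧ d * e.1 - c * e.2 = 1 := by
    intro p hp
    obtain ⟨e, e1, e2, rfl | rfl⟩ := exists_free_direction hp
    · exact ⟨(1 / d, 0), fun h => by simpa using e1 h, fun _ => rfl, by field_simp; simp⟩
    · exact ⟨(0, -1 / c), fun _ => rfl, fun h => by simpa using e2 h, by field_simp; simp⟩
  have hne_zero : ∀ e : Pt, d * e.1 - c * e.2 = 1 → e ≠ 0 := by
    rintro e he rfl
    simp at he
  have heq : d * (z i).1 + c * (z i).2 = d * (z j).1 + c * (z j).2 → z i = z j := by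
    intro e
    refine Prod.ext (mul_left_cancel₀ hd'.ne' (by linarith))
      (mul_left_cancel₀ hc'.ne' (by linarith))
  have hcorj : AtCorner (z j) := by
    by_contra hcor'
    obtain ⟨e, e1, e2, he⟩ := hfree _ hcor
    by_cases hzz : z i = z j
    · exact hne_zero e he (hz.eq_zero_of_pair hij (a := e) (b := e) (fun _ => rfl) (fun _ => rfl)
        e1 e2 (hzz ▸ e1) (hzz ▸ e2))
    · obtain ⟨e', e1', e2', he'⟩ := hfree _ hcor'
      exact hne_zero e he (hz.eq_zero_of_pair hij (a := e) (b := e')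
        (fun h' => absurd (heq h') hzz) (fun _ => he.trans he'.symm) e1 e2 e1' e2')
  have hzz : z i ≠ z j := fun h' => hcor (h' ▸ hcorj)
  by_cases hy : (z i).2 = 0 ∨ (z i).2 = 1
  · have hint : ∀ x : ℝ, x = 0 ∨ x = 1 → ∃ n : ℤ, x = n := by
      rintro x (rfl | rfl)
      exacts [⟨0, by simp⟩, ⟨1, by simp⟩]
    obtain ⟨k, hk⟩ := hint _ hy
    obtain ⟨l, hl⟩ := hint _ hcorj.1
    obtain ⟨m, hm⟩ := hint _ hcorj.2
    refine ⟨.of_mul_eq hd.ne' (n := c * (k - m) + d * l) ?_,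
      .of_mul_eq hd.ne' (n := d * k) ?_⟩
    · push_cast
      rw [← hk, ← hl, ← hm]; linarith
    · push_cast
      rw [← hk]
  exfalso
  by_cases hx : (z i).1 = 0 ∨ (z i).1 = 1
  · have hsq := mem_unitSq.1 (hz.1 i)
    push Not at hy
    have hy0 := lt_of_le_of_ne hsq.2.2.1 hy.1.symm
    have hy1 := lt_of_le_of_ne hsq.2.2.2 hy.2
    have hxx : (z i).1 ≠ (z j).1 := fun e => hzz (heq (by rw [e] at h ⊢; linarith))
    rcases hx with hx | hx <;> rcases hcorj.1 with hX | hX <;> rcases hcorj.2 with hY | hY <;>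
      rw [hx, hX] at hxx h <;> rw [hY] at h <;> first | exact hxx rfl | nlinarith
  · have := hz.eq_zero_of_pair hij (a := (c, d)) (b := 0)
      (fun h' => absurd (heq h') hzz) (fun _ => by simp; ring) (fun h' => absurd h' hx)
      (fun h' => absurd h' hy) (fun _ => rfl) (fun _ => rfl)
    exact hc'.ne' (congrArg Prod.fst this)

theorem IsRigid.ptDenDvd_two {c d : ℕ} (hc : 0 < c) (hcd : c ≤ d)
    {z : Conf 2} (hz : IsRigid c d z) (i : Fin 2) : PtDenDvd (z i) d := by
  have hd : d ≠ 0 := (hc.trans_le hcd).ne'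
  by_cases hminus : ∃ j ≠ i, d * (z i).1 - c * (z i).2 = d * (z j).1 - c * (z j).2
  · obtain ⟨j, hj, h⟩ := hminus
    exact hz.ptDenDvd_of_attack hc hcd hj.symm h
  by_cases hplus : ∃ j ≠ i, d * (z i).1 + c * (z i).2 = d * (z j).1 + c * (z j).2
  · obtain ⟨j, hj, h⟩ := hplus
    obtain ⟨h₁, h₂⟩ := hz.reflect.ptDenDvd_of_attack hc hcd hj.symm (by dsimp only; linarith)
    obtain ⟨n, hn⟩ := h₂.exists_mul_eq
    refine ⟨h₁, .of_mul_eq hd (n := d - n) ?_⟩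
    push_cast
    rw [← hn]; ring
  push Not at hminus hplus
  exact (hz.atCorner_of_not_attack hplus hminus).ptDenDvd d

/-! ### Lower bounds -/

theorem IsMotion.eq_zero_of_corner {c d q : ℕ} {z δ : Conf q} (h : IsMotion c d z δ) {i : Fin q}
    (hi : AtCorner (z i)) : δ i = 0 :=
  Prod.ext (h.fst i hi.1) (h.snd i hi.2)

theorem eq_zero_of_lines {c d : ℕ} (hc : 0 < c) (hd : 0 < d) {p : Pt}
    (hminus : d * p.1 - c * p.2 = 0) (hplus : d * p.1 + c * p.2 = 0) : p = 0 := by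
  have h1 : (d : ℝ) * p.1 = 0 := by linarith
  have h2 : (c : ℝ) * p.2 = 0 := by linarith
  exact Prod.ext ((mul_eq_zero.1 h1).resolve_left (by exact_mod_cast hd.ne'))
    ((mul_eq_zero.1 h2).resolve_left (by exact_mod_cast hc.ne'))

theorem dvd_of_two_le {c d q : ℕ} (hc : 0 < c) (hcd : c ≤ d) (hco : Nat.Coprime c d) (hq : 2 ≤ q)
    {D : ℕ} (hD : ∀ z : Conf q, IsRigid c d z → ∀ i, PtDenDvd (z i) D) : d ∣ D := by
  have hd : 0 < d := hc.trans_le hcd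
  have hd' : (0 : ℝ) < d := by exact_mod_cast hd
  have hcd' : (c : ℝ) ≤ d := by exact_mod_cast hcd
  let i₀ : Fin q := ⟨0, by omega⟩
  let i₁ : Fin q := ⟨1, by omega⟩
  have h01 : i₀ ≠ i₁ := by simp [i₀, i₁]
  let z : Conf q := fun i => if i = i₁ then (c / d, 1) else (0, 0)
  have z1 : z i₁ = ((c / d : ℝ), (1 : ℝ)) := if_pos rfl
  have zo : ∀ i ≠ i₁, z i = (0, 0) := fun i hi => if_neg hi
  have hz : IsRigid c d z := by
    refine ⟨fun i => ?_, fun δ hδ => ?_⟩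
    · by_cases hi : i = i₁
      · rw [hi, z1, mem_unitSq]
        exact ⟨by positivity, (div_le_one hd').2 hcd', zero_le_one, le_rfl⟩
      · rw [zo i hi, mem_unitSq]; norm_num
    · have ho : ∀ i ≠ i₁, δ i = 0 := fun i hi =>
        hδ.eq_zero_of_corner (by rw [zo i hi]; exact ⟨Or.inl rfl, Or.inl rfl⟩)
      funext i
      by_cases hi : i = i₁
      · rw [hi]
        have h2 := hδ.snd i₁ (by rw [z1]; exact Or.inr rfl)
        have := hδ.minus i₁ i₀ (by rw [z1, zo i₀ h01]; field_simp; ring)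
        rw [ho i₀ h01, h2] at this
        refine Prod.ext ?_ h2
        simpa [hd'.ne'] using this
      · exact ho i hi
  obtain ⟨n, hn⟩ := (hD z hz i₁).1.exists_mul_eq
  rw [z1] at hn
  have : (D * c : ℤ) = n * d := by
    have : (D * c : ℝ) = n * d := by rw [← hn]; field_simp
    exact_mod_cast this
  exact hco.symm.dvd_of_dvd_mul_right (by
    have : (d : ℤ) ∣ D * c := ⟨n, by rw [this, mul_comm]⟩
    exact_mod_cast this)

theorem dvd_of_three_le {c d q : ℕ} (hc : 0 < c) (hcd : c ≤ d) (hco : Nat.Coprime c d)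
    (hq : 3 ≤ q) {D : ℕ} (hD : ∀ z : Conf q, IsRigid c d z → ∀ i, PtDenDvd (z i) D) :
    2 * d ∣ D := by
  have hd : 0 < d := hc.trans_le hcd
  have hc' : (0 : ℝ) < c := by exact_mod_cast hc
  have hd' : (0 : ℝ) < d := by exact_mod_cast hd
  have hcd' : (c : ℝ) ≤ d := by exact_mod_cast hcd
  let i₀ : Fin q := ⟨0, by omega⟩
  let i₁ : Fin q := ⟨1, by omega⟩
  let i₂ : Fin q := ⟨2, by omega⟩
  let z : Conf q := fun i =>
    if i = i₁ then (0, 1) else if i = i₂ then (c / (2 * d), 1 / 2) else (0, 0)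
  have z0 : z i₀ = (0, 0) := by simp [z, i₀, i₁, i₂]
  have z1 : z i₁ = (0, 1) := if_pos rfl
  have z2 : z i₂ = ((c / (2 * d) : ℝ), (1 / 2 : ℝ)) := by simp [z, i₁, i₂]
  have zo : ∀ i ≠ i₂, AtCorner (z i) := by
    intro i hi
    by_cases h1 : i = i₁
    · rw [h1, z1]; exact ⟨Or.inl rfl, Or.inr rfl⟩
    · simp only [z, h1, hi, if_false]; exact ⟨Or.inl rfl, Or.inl rfl⟩
  have hz : IsRigid c d z := by
    refine ⟨fun i => ?_, fun δ hδ => ?_⟩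
    · by_cases hi : i = i₂
      · rw [hi, z2, mem_unitSq]
        exact ⟨by positivity, (div_le_one (by positivity)).2 (by linarith), by norm_num,
          by norm_num⟩
      · have := zo i hi
        rw [mem_unitSq]
        rcases this with ⟨h | h, h' | h'⟩ <;> rw [h, h'] <;> norm_num
    · funext i
      by_cases hi : i = i₂
      · rw [hi]
        have hm := hδ.minus i₂ i₀ (by rw [z2, z0]; field_simp; ring)
        have hp := hδ.plus i₂ i₁ (by rw [z2, z1]; field_simp; ring)
        rw [hδ.eq_zero_of_corner (zo i₀ (by simp [i₀, i₂]))] at hm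
        rw [hδ.eq_zero_of_corner (zo i₁ (by simp [i₁, i₂]))] at hp
        simp only [Prod.fst_zero, Prod.snd_zero] at hm hp
        exact eq_zero_of_lines hc hd (by linarith) (by linarith)
      · exact hδ.eq_zero_of_corner (zo i hi)
  obtain ⟨m, hm⟩ := (hD z hz i₂).1.exists_mul_eq
  obtain ⟨n, hn⟩ := (hD z hz i₂).2.exists_mul_eq
  rw [z2] at hm hn
  have h2 : (D : ℤ) = 2 * n := by
    have : (D : ℝ) = 2 * n := by rw [← hn]; ring
    exact_mod_cast this
  have h3 : (D * c : ℤ) = 2 * (m * d) := by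
    have : (D * c : ℝ) = 2 * (m * d) := by rw [← hm]; field_simp
    exact_mod_cast this
  have h4 : n * c = m * d := by rw [h2] at h3; linarith
  have h5 : (d : ℤ) ∣ n := (Nat.isCoprime_iff_coprime.2 hco.symm).dvd_of_dvd_mul_right
    ⟨m, by rw [h4, mul_comm]⟩
  have : (2 * d : ℤ) ∣ D := by rw [h2]; exact mul_dvd_mul_left 2 h5
  exact_mod_cast this

/-- A trajectory of `N + 1` points started at a corner, bouncing between the horizontal sides,
then a corner on the opposite side, then a crossing point of lines through the last two. -/
def bounce (c d N : ℕ) (k : ℕ) : Pt :=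
  if k ≤ N then (k * c / d, if Even k then 0 else 1)
  else if k = N + 1 then (1, if Even N then 0 else 1)
  else if k = N + 2 then ((d + N * c) / (2 * d),
    if Even N then (d - N * c) / (2 * c) else 1 - (d - N * c) / (2 * c))
  else (0, 0)

theorem isRigid_bounce {c d q N : ℕ} (hc : 0 < c) (hd : 0 < d) (hN : N + 3 ≤ q)
    (hN₁ : N * c ≤ d) (hN₂ : d ≤ (N + 2) * c) :
    IsRigid c d (fun i : Fin q => bounce c d N i) := by
  have hc' : (0 : ℝ) < c := by exact_mod_cast hc
  have hd' : (0 : ℝ) < d := by exact_mod_cast hd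
  have hN₁' : (N * c : ℝ) ≤ d := by exact_mod_cast hN₁
  have hN₂' : (d : ℝ) ≤ (N + 2) * c := by exact_mod_cast hN₂
  have b1 : ∀ k ≤ N, bounce c d N k = ((k * c / d : ℝ), if Even k then 0 else 1) :=
    fun k hk => if_pos hk
  have b2 : bounce c d N (N + 1) = (1, if Even N then 0 else 1) := by simp [bounce]
  have b3 : bounce c d N (N + 2) = ((d + N * c : ℝ) / (2 * d),
      if Even N then (d - N * c : ℝ) / (2 * c) else 1 - (d - N * c : ℝ) / (2 * c)) := by
    simp [bounce]
  have b4 : ∀ k, N + 2 < k → bounce c d N k = (0, 0) := by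
    intro k hk
    rw [bounce, if_neg (by omega), if_neg (by omega), if_neg (by omega)]
  have hcases : ∀ k, k ≤ N ∨ k = N + 1 ∨ k = N + 2 ∨ N + 2 < k := by omega
  have hNd : (N * c / d : ℝ) ≤ 1 := (div_le_one hd').2 hN₁'
  refine ⟨fun i => ?_, fun δ hδ => ?_⟩
  · rw [mem_unitSq]
    dsimp only
    rcases hcases i with h | h | h | h
    · rw [b1 _ h]
      have : ((i : ℕ) * c / d : ℝ) ≤ N * c / d := by gcongr
      refine ⟨by positivity, this.trans hNd, ?_⟩
      dsimp only
      split_ifs <;> norm_num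
    · rw [h, b2]
      refine ⟨zero_le_one, le_rfl, ?_⟩
      dsimp only
      split_ifs <;> norm_num
    · rw [h, b3]
      have h0 : 0 ≤ (d - N * c : ℝ) / (2 * c) := div_nonneg (by linarith) (by positivity)
      have h1 : (d - N * c : ℝ) / (2 * c) ≤ 1 := (div_le_one (by positivity)).2 (by linarith)
      refine ⟨by positivity, (div_le_one (by positivity)).2 (by linarith), ?_⟩
      dsimp only
      split_ifs <;> constructor <;> linarith
    · rw [b4 _ h]; norm_num
  · have step : ∀ k (hk : k ≤ N), δ ⟨k, by omega⟩ = 0 := by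
      intro k
      induction k with
      | zero =>
        intro hk
        refine hδ.eq_zero_of_corner ?_
        dsimp only
        rw [b1 0 hk]
        simp [AtCorner]
      | succ k ih =>
        intro hk
        have ih := ih (by omega)
        have h2 : (δ ⟨k + 1, by omega⟩).2 = 0 := by
          refine hδ.snd _ ?_
          dsimp only
          rw [b1 _ hk]
          dsimp only
          split_ifs <;> simp
        refine Prod.ext ?_ h2
        by_cases hev : Even k
        · have := hδ.minus ⟨k + 1, by omega⟩ ⟨k, by omega⟩ (by
            dsimp only
            rw [b1 _ hk, b1 k (by omega)]
            simp only [hev, Nat.even_add_one, not_true, if_true, if_false]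
            push_cast; field_simp; ring)
          rw [ih, h2] at this
          simpa [hd'.ne'] using this
        · have := hδ.plus ⟨k + 1, by omega⟩ ⟨k, by omega⟩ (by
            dsimp only
            rw [b1 _ hk, b1 k (by omega)]
            simp only [hev, Nat.even_add_one, not_false_iff, if_true, if_false]
            push_cast; field_simp; ring)
          rw [ih, h2] at this
          simpa [hd'.ne'] using this
    have hlast := step N le_rfl
    have hcorner : δ ⟨N + 1, by omega⟩ = 0 := by
      refine hδ.eq_zero_of_corner ?_
      dsimp only
      rw [b2]
      refine ⟨Or.inr rfl, ?_⟩
      dsimp only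
      split_ifs <;> simp
    have hcross : δ ⟨N + 2, by omega⟩ = 0 := by
      have hpm : d * (δ ⟨N + 2, by omega⟩).1 - c * (δ ⟨N + 2, by omega⟩).2 = 0 ∧
          d * (δ ⟨N + 2, by omega⟩).1 + c * (δ ⟨N + 2, by omega⟩).2 = 0 := by
        by_cases hev : Even N
        · have hm := hδ.minus ⟨N + 2, by omega⟩ ⟨N, by omega⟩ (by
            dsimp only
            rw [b3, b1 N le_rfl]
            simp only [hev, if_true]
            field_simp; ring)
          have hp := hδ.plus ⟨N + 2, by omega⟩ ⟨N + 1, by omega⟩ (by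
            dsimp only
            rw [b3, b2]
            simp only [hev, if_true]
            field_simp; ring)
          rw [hlast] at hm
          rw [hcorner] at hp
          exact ⟨by simpa using hm, by simpa using hp⟩
        · have hp := hδ.plus ⟨N + 2, by omega⟩ ⟨N, by omega⟩ (by
            dsimp only
            rw [b3, b1 N le_rfl]
            simp only [hev, if_false]
            field_simp; ring)
          have hm := hδ.minus ⟨N + 2, by omega⟩ ⟨N + 1, by omega⟩ (by
            dsimp only
            rw [b3, b2]
            simp only [hev, if_false]
            field_simp; ring)
          rw [hlast] at hp
          rw [hcorner] at hm
          exact ⟨by simpa using hm, by simpa using hp⟩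
      exact eq_zero_of_lines hc hd hpm.1 hpm.2
    funext i
    rcases hcases i with h | h | h | h
    · exact step i h
    · rw [show i = ⟨N + 1, by omega⟩ from Fin.ext h]; exact hcorner
    · rw [show i = ⟨N + 2, by omega⟩ from Fin.ext h]; exact hcross
    · refine hδ.eq_zero_of_corner ?_
      rw [b4 _ h]
      simp [AtCorner]

theorem dvd_of_ceil_lt {c d q : ℕ} (hc : 0 < c) (hcd : c ≤ d) (hco : Nat.Coprime c d)
    (hq : 3 ≤ q) (hq' : (d + c - 1) / c < q) {D : ℕ}
    (hD : ∀ z : Conf q, IsRigid c d z → ∀ i, PtDenDvd (z i) D) : 2 * c * d ∣ D := by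
  have hd : 0 < d := hc.trans_le hcd
  have hc' : (c : ℝ) ≠ 0 := by exact_mod_cast hc.ne'
  obtain ⟨e, rfl⟩ := dvd_of_three_le hc hcd hco hq hD
  obtain ⟨N, hN, hN₁, hN₂⟩ : ∃ N, N + 3 ≤ q ∧ N * c ≤ d ∧ d ≤ (N + 2) * c := by
    have h1 := Nat.div_mul_le_self (d + c - 1) c
    have h2 := Nat.lt_div_mul_add hc (a := d + c - 1)
    refine ⟨(d + c - 1) / c - 2, by omega, ?_, ?_⟩
    · rw [Nat.sub_mul]; omega
    · have : (d + c - 1) / c * c ≤ ((d + c - 1) / c - 2 + 2) * c :=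
        Nat.mul_le_mul_right c (by omega)
      omega
  obtain ⟨m, hm⟩ := (hD _ (isRigid_bounce hc hd hN hN₁ hN₂) ⟨N + 2, by omega⟩).2.exists_mul_eq
  have key : ∃ l : ℤ, (d * e : ℤ) * (d - N * c) = c * l := by
    by_cases hev : Even N
    · refine ⟨m, ?_⟩
      have : (d * e : ℝ) * (d - N * c) = c * m := by
        rw [← hm]; simp [bounce, hev]; field_simp
      exact_mod_cast this
    · refine ⟨2 * d * e - m, ?_⟩
      have : (d * e : ℝ) * (d - N * c) = c * (2 * d * e - m) := by
        rw [← hm]; simp [bounce, hev]; field_simp; ring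
      exact_mod_cast this
  obtain ⟨l, hl⟩ := key
  have h1 : (c : ℤ) ∣ d * (d * e) := ⟨l + d * e * N, by linear_combination hl⟩
  have h2 : c ∣ e := hco.dvd_of_dvd_mul_left (hco.dvd_of_dvd_mul_left (by exact_mod_cast h1))
  obtain ⟨k, rfl⟩ := h2
  exact ⟨k, by ring⟩

theorem isRigidDenom {c d q : ℕ} (hc : 0 < c) (hcd : c ≤ d) (hco : Nat.Coprime c d)
    (hq : 1 ≤ q) :
    IsRigidDenom c d q (if q = 1 then 1 else if q = 2 then d
      else if q ≤ (d + c - 1) / c then 2 * d else 2 * c * d) := by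
  have hd : 0 < d := hc.trans_le hcd
  split_ifs with h1 h2 h3
  · subst h1
    refine ⟨fun z hz i => ?_, fun D' _ => one_dvd D'⟩
    exact (hz.atCorner_of_not_attack (fun j hj => absurd (Subsingleton.elim j i) hj)
      (fun j hj => absurd (Subsingleton.elim j i) hj)).ptDenDvd 1
  · subst h2
    exact ⟨fun z hz i => hz.ptDenDvd_two hc hcd i,
      fun D' hD' => dvd_of_two_le hc hcd hco le_rfl hD'⟩
  · refine ⟨fun z hz i => ?_, fun D' hD' => dvd_of_three_le hc hcd hco (by omega) hD'⟩
    obtain ⟨m, n, hm, hn⟩ := hz.exists_int hc hd i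
    obtain ⟨k, hk⟩ := hz.exists_int_two_mul_snd hc hd h3 i
    refine ⟨.of_mul_eq (by positivity) (n := m + n) ?_, .of_mul_eq (by positivity) (n := d * k) ?_⟩
    · push_cast; rw [← hm, ← hn]; ring
    · push_cast; rw [← hk]; ring
  · refine ⟨fun z hz i => ?_, fun D' hD' =>
      dvd_of_ceil_lt hc hcd hco (by omega) (by omega) hD'⟩
    obtain ⟨m, n, hm, hn⟩ := hz.exists_int hc hd i
    refine ⟨.of_mul_eq (by positivity) (n := c * (m + n)) ?_,
      .of_mul_eq (by positivity) (n := d * (m - n)) ?_⟩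
    · push_cast; rw [← hm, ← hn]; ring
    · push_cast; rw [← hm, ← hn]; ring

end

noncomputable section

/-- The denominator of the inside-out polytope for the piece with moves `(c, d)` and
`(c, -d)` on the square board, where `ĉ = min c d` and `d̂ = max c d`:
it is `1` for `q = 1`, `d̂` for `q = 2`, `2d̂` for `3 ≤ q ≤ ⌈d̂/ĉ⌉`, and `2ĉd̂`
for `q ≥ 3` with `q ≥ ⌈d̂/ĉ⌉ + 1`. -/
theorem iopDenom_sum_zero_slopes (c d : ℕ) (hc : 0 < c) (hd : 0 < d)
    (hcd : Nat.Coprime c d)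
    (Bd : Board) (hBd : Bd.set = unitSq)
    (P : Piece) (h1 : P.c false = (c : ℤ)) (h2 : P.d false = (d : ℤ))
    (h3 : P.c true = (c : ℤ)) (h4 : P.d true = -(d : ℤ))
    (q : ℕ) (hq : 1 ≤ q) :
    IsIOPDenom Bd P q
      (if q = 1 then 1
       else if q = 2 then max c d
       else if q ≤ (max c d + min c d - 1) / min c d then 2 * max c d
       else 2 * min c d * max c d) := by
  rw [IsIOPDenom]
  simp only [isVertex_iff_isRigid Bd hBd P h1 h2 h3 h4]
  rcases le_total c d with h | h
  · rw [max_eq_right h, min_eq_left h]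
    exact isRigidDenom hc h hcd hq
  · rw [max_eq_left h, min_eq_right h]
    exact (isRigidDenom hd h hcd.symm hq).swap

end
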